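/- arXiv:2504.14880 — 4 statements merged into one kernel-verified Lean document; each statement's English description precedes it below -/
import Mathlib

section
/- Let w : ℝⁿ×ℝ → ℝ^d be a locally integrable measurable map, and let x, y ∈ ℝⁿ with x ≠ y. If w is backwardly self-similar at (x,0) and at (y,0), then w is backwardly invariant with respect to the one-dimensional subspace V = span{y−x}, i.e. for every v ∈ V, w(z+v,s) = w(z,s) for almost every (z,s) ∈ ℝⁿ×(−∞,0). -/
noncomputable section

open MeasureTheory Metric Set Filter Topology Real

abbrev Eu (n : ℕ) : Type := EuclideanSpace ℝ (Fin n)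
abbrev Spt (n : ℕ) : Type := Eu n × ℝ

/-- The parabolic ball `P_r(X) = B_r(x) × (t - r², t + r²)`. -/
def pball {n : ℕ} (X : Spt n) (r : ℝ) : Set (Spt n) :=
  Metric.ball X.1 r ×ˢ Set.Ioo (X.2 - r ^ 2) (X.2 + r ^ 2)

/-- Time partial derivative of a test function. -/
def dtime {n : ℕ} (θ : Spt n → ℝ) (p : Spt n) : ℝ := fderiv ℝ θ p ((0 : Eu n), (1 : ℝ))

/-- Spatial partial derivative of a test function. -/
def dsp {n : ℕ} (θ : Spt n → ℝ) (i : Fin n) (p : Spt n) : ℝ :=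
  fderiv ℝ θ p (EuclideanSpace.single i (1 : ℝ), (0 : ℝ))

/-- `|∇u|²`, where `du p i a` is the weak derivative `∂ᵢ u^a (p)`. -/
def gradSq {n d : ℕ} (du : Spt n → Fin n → Fin d → ℝ) (p : Spt n) : ℝ :=
  ∑ i, ∑ a, du p i a ^ 2

/-- `|∂ₜ u|²`, where `ut p a` is the weak derivative `∂ₜ u^a (p)`. -/
def timeSq {n d : ℕ} (ut : Spt n → Fin d → ℝ) (p : Spt n) : ℝ := ∑ a, ut p a ^ 2


/-- `w` is backwardly self-similar at `X`: `T_{X,λ}w = T_{X,1}w` a.e. on `ℝⁿ × ℝ₋`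
for all `λ > 0`, where `T_{X,λ}w (y,s) = w (x + λy, t + λ²s)`. -/
def BackSelfSimilarMap {n d : ℕ} (w : Spt n → Fin d → ℝ) (X : Spt n) : Prop :=
  ∀ l : ℝ, 0 < l → ∀ᵐ p : Spt n, p.2 < 0 →
    w (X.1 + l • p.1, X.2 + l ^ 2 * p.2) = w (X.1 + p.1, X.2 + p.2)

/-- `w` is backwardly invariant with respect to a linear subspace `V ⊆ ℝⁿ`. -/
def BackInvariantMap {n d : ℕ} (w : Spt n → Fin d → ℝ) (V : Submodule ℝ (Eu n)) : Prop :=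
  ∀ v ∈ V, ∀ᵐ p : Spt n, p.2 < 0 → w (p.1 + v, p.2) = w p

theorem qmp_affine {E : Type*} [NormedAddCommGroup E] [NormedSpace ℝ E] [MeasurableSpace E]
    [BorelSpace E] [FiniteDimensional ℝ E] (μ : Measure E) [μ.IsAddHaarMeasure]
    (a : E) {l : ℝ} (hl : l ≠ 0) :
    Measure.QuasiMeasurePreserving (fun z : E => a + l • z) μ μ := by
  have h1 : Measure.QuasiMeasurePreserving (fun z : E => l • z) μ μ := by
    refine ⟨measurable_const_smul l, ?_⟩
    have h := Measure.map_addHaar_smul μ hl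
    rw [h]
    exact Measure.smul_absolutelyContinuous
  exact (measurePreserving_add_left μ a).quasiMeasurePreserving.comp h1

theorem qmp_prod {n : ℕ} (a : Eu n) {l m : ℝ} (hl : l ≠ 0) (hm : m ≠ 0) :
    Measure.QuasiMeasurePreserving (fun p : Spt n => ((a + l • p.1, m * p.2) : Spt n))
      volume volume := by
  have h1 := qmp_affine (volume : Measure (Eu n)) a hl
  have h2 := qmp_affine (volume : Measure ℝ) 0 hm
  have h3 := MeasureTheory.QuasiMeasurePreserving.prodMap h1 h2
  simpa [Prod.map_def, Measure.volume_eq_prod] using h3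

theorem shift_lt {n d : ℕ} (w : Spt n → Fin d → ℝ) (x y : Eu n)
    (hx : BackSelfSimilarMap w (x, 0)) (hy : BackSelfSimilarMap w (y, 0))
    (c : ℝ) (hc : c < 1) :
    ∀ᵐ p : Spt n, p.2 < 0 → w (p.1 + c • (y - x), p.2) = w p := by
  have hk : 0 < 1 - c := by linarith
  have hl : 0 < (1 - c)⁻¹ := inv_pos.2 hk
  have e1 := (qmp_prod (-x) (one_ne_zero) (one_ne_zero)).ae (hx _ hl)
  have e2 := (qmp_prod (x - y - (1 - c)⁻¹ • x) hl.ne' (pow_pos hl 2).ne').ae (hy _ hk)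
  filter_upwards [e1, e2] with p h1 h2 hp
  have h1 := h1 (by simpa using hp)
  have h2 := h2 (mul_neg_of_pos_of_neg (pow_pos hl 2) hp)
  have a1 : y + (1 - c) • (x - y - (1 - c)⁻¹ • x + (1 - c)⁻¹ • p.1) = p.1 + c • (y - x) := by
    rw [smul_add, smul_sub, smul_inv_smul₀ hk.ne', smul_inv_smul₀ hk.ne']
    module
  have a2 : (1 - c) ^ 2 * ((1 - c)⁻¹ ^ 2 * p.2) = p.2 := by
    field_simp
  have a3 : y + (x - y - (1 - c)⁻¹ • x + (1 - c)⁻¹ • p.1)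
      = x + (1 - c)⁻¹ • (-x + (1 : ℝ) • p.1) := by
    module
  have a4 : x + (-x + (1 : ℝ) • p.1) = p.1 := by module
  simp only [zero_add] at h1 h2
  rw [a1, a2, a3] at h2
  rw [a4, one_mul] at h1
  exact h2.trans h1

/-- Cone-splitting, Lemma 2.9, map version.
If a locally integrable measurable map `w : ℝⁿ × ℝ → ℝ^d` is backwardly self-similar
at `(x,0)` and at `(y,0)` with `x ≠ y`, then `w` is backwardly invariant with respect
to the one-dimensional subspace `span {y - x}`. -/
theorem statement7 {n d : ℕ} (w : Spt n → Fin d → ℝ)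
    (hmeas : ∀ a, Measurable fun p => w p a)
    (hloc : ∀ a, MeasureTheory.LocallyIntegrable (fun p => w p a) volume)
    (x y : Eu n) (hxy : x ≠ y)
    (hx : BackSelfSimilarMap w (x, 0)) (hy : BackSelfSimilarMap w (y, 0)) :
    BackInvariantMap w (Submodule.span ℝ {y - x}) := by
  intro v hv
  obtain ⟨c, rfl⟩ := Submodule.mem_span_singleton.1 hv
  rcases lt_or_ge c 1 with hc | hc
  · exact shift_lt w x y hx hy c hc
  · have h := shift_lt w x y hx hy (-c) (by linarith)
    have h' := (qmp_prod (c • (y - x)) (one_ne_zero) (one_ne_zero)).ae h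
    filter_upwards [h'] with p h1 hp
    have h1 := h1 (by simpa using hp)
    have a : c • (y - x) + (1 : ℝ) • p.1 + -c • (y - x) = p.1 := by module
    rw [a, one_mul, one_smul, add_comm] at h1
    exact h1.symm
end
end

section
/- Let μ be a Radon measure on ℝⁿ×ℝ, and let x, y ∈ ℝⁿ with x ≠ y. If μ is backwardly self-similar at (x,0) and at (y,0), then μ is backwardly invariant with respect to the one-dimensional subspace V = span{y−x}, i.e. for every v ∈ V, the translate μ(· + (v,0)) agrees with μ on all Borel subsets of ℝⁿ×(−∞,0). -/
noncomputable section

open MeasureTheory Metric Set Filter Topology Real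

/-- The set of backward times `ℝⁿ × ℝ₋`. -/
def negTimes (n : ℕ) : Set (Spt n) := {p : Spt n | p.2 < 0}

/-- The parabolic rescaling `T_{X,λ}μ (A) = λ^{-n} μ (𝒫_{X,λ}^{-1}(A))`,
where `𝒫_{X,λ}^{-1}(y,s) = (x + λ y, t + λ² s)`. -/
def scaledMeas {n : ℕ} (X : Spt n) (l : ℝ) (μ : Measure (Spt n)) : Measure (Spt n) :=
  (ENNReal.ofReal (l⁻¹ ^ n)) •
    Measure.map (fun p : Spt n => (l⁻¹ • (p.1 - X.1), (p.2 - X.2) / l ^ 2)) μ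

/-- `μ` is backwardly self-similar at `X`. -/
def BackSelfSimilarMeas {n : ℕ} (μ : Measure (Spt n)) (X : Spt n) : Prop :=
  ∀ l : ℝ, 0 < l →
    (scaledMeas X l μ).restrict (negTimes n) = (scaledMeas X 1 μ).restrict (negTimes n)

/-- `μ` is backwardly invariant with respect to a linear subspace `V ⊆ ℝⁿ`:
the translate `μ(· + (v,0))` agrees with `μ` on `ℝⁿ × ℝ₋` for every `v ∈ V`. -/
def BackInvariantMeas {n : ℕ} (μ : Measure (Spt n)) (V : Submodule ℝ (Eu n)) : Prop :=
  ∀ v ∈ V,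
    (Measure.map (fun p : Spt n => (p.1 - v, p.2)) μ).restrict (negTimes n)
      = μ.restrict (negTimes n)

theorem measurableSet_negTimes' (n : ℕ) : MeasurableSet (negTimes n) :=
  measurableSet_lt measurable_snd measurable_const

/-- Dilation about `(x,0)` scales `μ` on backward sets. -/
theorem selfSim_aux {n : ℕ} {μ : Measure (Spt n)} {x : Eu n}
    (hx : BackSelfSimilarMeas μ (x, 0)) {k : ℝ} (hk : 0 < k) {B : Set (Spt n)}
    (hB : MeasurableSet B) (hBn : B ⊆ negTimes n) :
    ENNReal.ofReal (k ^ n) * μ {p : Spt n | (x + k • (p.1 - x), k ^ 2 * p.2) ∈ B} = μ B := by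
  have h := hx k⁻¹ (inv_pos.mpr hk)
  have hA : MeasurableSet ((fun p : Spt n => (p.1 + x, p.2)) ⁻¹' B) := by
    apply MeasurableSet.preimage hB
    fun_prop
  have hAn : (fun p : Spt n => (p.1 + x, p.2)) ⁻¹' B ⊆ negTimes n := by
    intro p hp
    have h3 : (p.1 + x, p.2) ∈ negTimes n := hBn hp
    exact h3
  have h2 := congrArg (fun ν : Measure (Spt n) => ν ((fun p : Spt n => (p.1 + x, p.2)) ⁻¹' B)) h
  simp only [Measure.restrict_apply hA, inter_eq_self_of_subset_left hAn, scaledMeas,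
    Measure.smul_apply, smul_eq_mul] at h2
  rw [Measure.map_apply (by fun_prop) hA, Measure.map_apply (by fun_prop) hA] at h2
  convert h2 using 1
  · simp only [inv_inv]
    congr 2
    ext p
    simp only [mem_ofPred_eq, mem_preimage, sub_zero, inv_pow, div_inv_eq_mul]
    rw [add_comm, mul_comm]
  · simp [preimage_preimage]

theorem trans_aux {n : ℕ} {μ : Measure (Spt n)} {x y : Eu n}
    (hx : BackSelfSimilarMeas μ (x, 0)) (hy : BackSelfSimilarMeas μ (y, 0))
    {c : ℝ} (hc : c < 1) {B : Set (Spt n)}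
    (hB : MeasurableSet B) (hBn : B ⊆ negTimes n) :
    μ {p : Spt n | (p.1 - c • (y - x), p.2) ∈ B} = μ B := by
  obtain ⟨k, hk⟩ : ∃ k, k = 1 - c := ⟨_, rfl⟩
  have hk0 : 0 < k := by linarith
  have hkn : k ≠ 0 := hk0.ne'
  have h1 := selfSim_aux hx hk0 hB hBn
  have hm : MeasurableSet {p : Spt n | (x + k • (p.1 - x), k ^ 2 * p.2) ∈ B} := by
    have hf : Measurable (fun p : Spt n => (x + k • (p.1 - x), k ^ 2 * p.2)) := by fun_prop
    exact hf hB
  have hn : {p : Spt n | (x + k • (p.1 - x), k ^ 2 * p.2) ∈ B} ⊆ negTimes n := by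
    intro p hp
    have h3 : k ^ 2 * p.2 < 0 := hBn hp
    have h4 : 0 < k ^ 2 := by positivity
    show p.2 < 0
    by_contra h5
    have := mul_nonneg h4.le (not_lt.mp h5)
    linarith
  have h2 := selfSim_aux hy (inv_pos.mpr hk0) hm hn
  rw [← h2, ← mul_assoc, ← ENNReal.ofReal_mul (by positivity), ← mul_pow,
    mul_inv_cancel₀ hkn, one_pow, ENNReal.ofReal_one, one_mul] at h1
  rw [← h1]
  congr 1
  ext p
  have e1 : x + k • (y + k⁻¹ • (p.1 - y) - x) = p.1 - c • (y - x) := by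
    have : k • (y + k⁻¹ • (p.1 - y) - x) = k • (y - x) + (p.1 - y) := by
      rw [add_sub_right_comm, smul_add, smul_inv_smul₀ hkn]
    rw [this, hk]
    module
  have e2 : k ^ 2 * (k⁻¹ ^ 2 * p.2) = p.2 := by field_simp
  simp only [mem_ofPred_eq, e1, e2]

/-- Cone-splitting, Lemma 2.9, measure version.
If a Radon measure `μ` on `ℝⁿ × ℝ` is backwardly self-similar at `(x,0)` and at
`(y,0)` with `x ≠ y`, then `μ` is backwardly invariant with respect to the
one-dimensional subspace `span {y - x}`. -/
theorem statement8 {n : ℕ} (μ : Measure (Spt n)) [IsLocallyFiniteMeasure μ]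
    (x y : Eu n) (hxy : x ≠ y)
    (hx : BackSelfSimilarMeas μ (x, 0)) (hy : BackSelfSimilarMeas μ (y, 0)) :
    BackInvariantMeas μ (Submodule.span ℝ {y - x}) := by
  intro v hv
  obtain ⟨c, rfl⟩ := Submodule.mem_span_singleton.mp hv
  ext A hA
  have hN := measurableSet_negTimes' n
  rw [Measure.restrict_apply hA, Measure.restrict_apply hA,
    Measure.map_apply (by fun_prop) (hA.inter hN)]
  rcases lt_or_ge c 1 with hc | hc
  · exact trans_aux hx hy hc (hA.inter hN) inter_subset_right
  · have h := trans_aux hy hx (c := -c) (by linarith) (hA.inter hN) inter_subset_right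
    have e : (-c) • (x - y) = c • (y - x) := by module
    rw [e] at h
    exact h
end
end

section
/- Let k ∈ ℤ with 1 ≤ k ≤ n−1, let V ⊂ ℝⁿ be a k-dimensional linear subspace, and let x ∈ ℝⁿ with x ≠ 0. Suppose a locally integrable measurable map w : ℝⁿ×ℝ → ℝ^d is backwardly self-similar at 0^{n,1} := (0,0) and at (x,0), and is backwardly invariant with respect to V. Then w is backwardly invariant with respect to the subspace span(V ∪ {x}); in particular, if x ∉ V, then w is backwardly invariant with respect to a (k+1)-dimensional subspace. -/
noncomputable section

open MeasureTheory Metric Set Filter Topology Real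

/-- Almost-everywhere statements are stable under spatial translations. -/
theorem ae_spatial_shift {n : ℕ} {P : Spt n → Prop} (h : ∀ᵐ p : Spt n, P p) (v : Eu n) :
    ∀ᵐ p : Spt n, P (p.1 + v, p.2) := by
  have hq : MeasurePreserving (Prod.map (fun y : Eu n => y + v) (id : ℝ → ℝ))
      ((volume : Measure (Eu n)).prod (volume : Measure ℝ))
      ((volume : Measure (Eu n)).prod (volume : Measure ℝ)) :=
    (measurePreserving_add_right (volume : Measure (Eu n)) v).prod
      (MeasurePreserving.id (volume : Measure ℝ))
  exact hq.quasiMeasurePreserving.ae h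

theorem inv_of_gt {n d : ℕ} (x : Eu n) (w : Spt n → Fin d → ℝ)
    (h0 : BackSelfSimilarMap w ((0 : Eu n), (0 : ℝ)))
    (hx : BackSelfSimilarMap w (x, 0)) (c : ℝ) (hc : -1 < c) :
    ∀ᵐ p : Spt n, p.2 < 0 → w (p.1 + c • x, p.2) = w p := by
  have hc1 : 0 < 1 + c := by linarith
  have hl : 0 < (1 + c)⁻¹ := inv_pos.mpr hc1
  have h1 := ae_spatial_shift (hx _ hl) (-x)
  have h2 := ae_spatial_shift (h0 _ hl) (c • x)
  filter_upwards [h1, h2] with p hp1 hp2 hs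
  have a1 := hp1 hs
  have a2 := hp2 hs
  simp only [zero_add] at a1 a2
  have e : x + (1 + c)⁻¹ • (p.1 + -x) = (1 + c)⁻¹ • (p.1 + c • x) := by
    have : x = (1 + c)⁻¹ • ((1 + c) • x) := by
      rw [smul_smul, inv_mul_cancel₀ hc1.ne', one_smul]
    nth_rewrite 1 [this]
    rw [← smul_add]
    congr 1
    rw [add_smul, one_smul]
    abel
  have e2 : x + (p.1 + -x) = p.1 := by abel
  rw [e, e2] at a1
  rw [← a2, a1]

theorem inv_all {n d : ℕ} (x : Eu n) (w : Spt n → Fin d → ℝ)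
    (h0 : BackSelfSimilarMap w ((0 : Eu n), (0 : ℝ)))
    (hx : BackSelfSimilarMap w (x, 0)) (c : ℝ) :
    ∀ᵐ p : Spt n, p.2 < 0 → w (p.1 + c • x, p.2) = w p := by
  rcases lt_or_ge (-1) c with hc | hc
  · exact inv_of_gt x w h0 hx c hc
  · have h := ae_spatial_shift (inv_of_gt x w h0 hx (-c) (by linarith)) (c • x)
    filter_upwards [h] with p hp hs
    have := hp hs
    simp only [neg_smul, add_neg_cancel_right] at this
    exact this.symm

/-- Corollary 2.10, map version.
If a locally integrable measurable map `w` is backwardly self-similar at `(0,0)` and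
at `(x,0)` with `x ≠ 0`, and backwardly invariant with respect to a `k`-dimensional
subspace `V` (`1 ≤ k ≤ n-1`), then `w` is backwardly invariant with respect to
`span (V ∪ {x})`; in particular, if `x ∉ V`, `w` is backwardly invariant with respect
to some `(k+1)`-dimensional subspace. -/
theorem statement9 {n d : ℕ} (k : ℕ) (hk1 : 1 ≤ k) (hk2 : k ≤ n - 1)
    (V : Submodule ℝ (Eu n)) (hV : Module.finrank ℝ V = k)
    (x : Eu n) (hx0 : x ≠ 0)
    (w : Spt n → Fin d → ℝ)
    (hmeas : ∀ a, Measurable fun p => w p a)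
    (hloc : ∀ a, MeasureTheory.LocallyIntegrable (fun p => w p a) volume)
    (h0 : BackSelfSimilarMap w ((0 : Eu n), (0 : ℝ)))
    (hx : BackSelfSimilarMap w (x, 0))
    (hinv : BackInvariantMap w V) :
    BackInvariantMap w (V ⊔ Submodule.span ℝ {x}) ∧
      (x ∉ V → ∃ W : Submodule ℝ (Eu n), Module.finrank ℝ W = k + 1 ∧
        BackInvariantMap w W) := by
  have key : BackInvariantMap w (V ⊔ Submodule.span ℝ {x}) := by
    intro u hu
    obtain ⟨v, hv, y, hy, rfl⟩ := Submodule.mem_sup.mp hu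
    obtain ⟨c, rfl⟩ := Submodule.mem_span_singleton.mp hy
    filter_upwards [hinv v hv, ae_spatial_shift (inv_all x w h0 hx c) v] with p h1 h2 hs
    rw [← h1 hs, ← h2 hs]
    simp only [add_assoc]
  refine ⟨key, fun hxV => ⟨_, ?_, key⟩⟩
  have hd : Disjoint V (Submodule.span ℝ {x}) :=
    (Submodule.disjoint_span_singleton_of_notMem hxV)
  have := Submodule.finrank_sup_add_finrank_inf_eq V (Submodule.span ℝ {x})
  rw [hd.eq_bot, finrank_bot, finrank_span_singleton hx0, hV] at this
  simpa using this
end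
end

section
/- Let μ be a Radon measure on ℝⁿ×ℝ satisfying the uniform growth bound μ(P_ρ(X)) ≤ Λ ρⁿ for all ρ > 0 and all X ∈ ℝⁿ×ℝ, for some Λ > 0. Suppose μ is backwardly self-similar at 0^{n,1} := (0,0) and backwardly invariant with respect to a linear subspace V ⊂ ℝⁿ. Then the Gaussian density Φ(μ,(x,0),ρ) := (1/2) ∫_{T_ρ((x,0))} G_{(x,0)}(y,s) dμ(y,s) is finite and satisfies Φ(μ,(x,0),ρ) = Φ(μ,0^{n,1},1) for every ρ > 0 and every x ∈ V. -/
noncomputable section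

open MeasureTheory Metric Set Filter Topology Real

/-- The backward heat kernel centered at `X₀`. -/
def heatKer (n : ℕ) (X₀ : Spt n) (p : Spt n) : ℝ :=
  (4 * π * (X₀.2 - p.2)) ^ (-(n : ℝ) / 2) *
    Real.exp (-‖p.1 - X₀.1‖ ^ 2 / (4 * (X₀.2 - p.2)))

/-- The time slab `T_ρ(X₀) = {t₀ - 4ρ² ≤ t ≤ t₀ - ρ²}`. -/
def Tslab {n : ℕ} (X₀ : Spt n) (ρ : ℝ) : Set (Spt n) :=
  {p : Spt n | X₀.2 - 4 * ρ ^ 2 ≤ p.2 ∧ p.2 ≤ X₀.2 - ρ ^ 2}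


theorem hk_meas {n : ℕ} (X : Spt n) : Measurable (heatKer n X) := by
  unfold heatKer
  fun_prop

theorem tslab_meas {n : ℕ} (X : Spt n) (ρ : ℝ) : MeasurableSet (Tslab X ρ) := by
  unfold Tslab
  exact (measurableSet_le measurable_const measurable_snd).inter
    (measurableSet_le measurable_snd measurable_const)

theorem tslab_neg {n : ℕ} (x : Eu n) (ρ : ℝ) (hρ : 0 < ρ) : Tslab (x, (0:ℝ)) ρ ⊆ negTimes n := by
  intro p hp
  have h2 := hp.2
  have : 0 < ρ ^ 2 := by positivity
  simp only [negTimes, mem_ofPred_eq]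
  simp only at h2
  linarith

theorem hk_bound {n : ℕ} (x : Eu n) (ρ : ℝ) (hρ : 0 < ρ) (k : ℕ) (p : Spt n)
    (hp : p ∈ Tslab (x, (0:ℝ)) ρ) (hk : (k : ℝ) ≤ ‖p.1 - x‖) :
    ‖heatKer n (x, 0) p‖ ≤
      (4 * π * ρ ^ 2) ^ (-(n : ℝ) / 2) * Real.exp (-(1 / (16 * ρ ^ 2)) * k) := by
  obtain ⟨h1, h2⟩ := hp
  simp only at h1 h2
  have hρ2 : 0 < ρ ^ 2 := by positivity
  have hs : 0 < 0 - p.2 := by linarith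
  have hpi := Real.pi_pos
  have hnn : 0 ≤ heatKer n (x, 0) p := by
    unfold heatKer
    simp only
    positivity
  rw [Real.norm_of_nonneg hnn]
  unfold heatKer
  simp only
  gcongr ?_ * ?_
  · apply Real.rpow_le_rpow_of_nonpos (by positivity)
    · gcongr
      linarith
    · have : (0:ℝ) ≤ n := Nat.cast_nonneg n
      linarith
  · rw [Real.exp_le_exp]
    have hkk : (k : ℝ) ≤ (k:ℝ) ^ 2 := by
      exact_mod_cast Nat.le_self_pow two_ne_zero k
    have hk2 : (k : ℝ) ^ 2 ≤ ‖p.1 - x‖ ^ 2 := by gcongr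
    rw [neg_div, neg_mul, neg_le_neg_iff, one_div, inv_mul_eq_div]
    apply div_le_div₀ (by positivity) (by linarith) (by linarith) (by linarith)

theorem hk_integrable {n : ℕ} (Λ : ℝ) (hΛ : 0 < Λ) (μ : Measure (Spt n))
    (hgrowth : ∀ ρ : ℝ, 0 < ρ → ∀ X : Spt n, μ (pball X ρ) ≤ ENNReal.ofReal (Λ * ρ ^ n))
    (ρ : ℝ) (hρ : 0 < ρ) (x : Eu n) :
    IntegrableOn (heatKer n (x, 0)) (Tslab ((x : Eu n), (0 : ℝ)) ρ) μ := by
  refine ⟨(hk_meas _).aestronglyMeasurable, ?_⟩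
  set c : ℝ := 1 / (16 * ρ ^ 2) with hc
  have hcpos : 0 < c := by positivity
  have hpi := Real.pi_pos
  set C : ℝ := (4 * π * ρ ^ 2) ^ (-(n : ℝ) / 2) with hC
  have hCpos : 0 < C := by positivity
  set A : ℕ → Set (Spt n) := fun k =>
    Tslab ((x : Eu n), (0 : ℝ)) ρ ∩ {p | (k : ℝ) ≤ ‖p.1 - x‖ ∧ ‖p.1 - x‖ < k + 1} with hA
  have hAm : ∀ k, MeasurableSet (A k) := by
    intro k
    refine (tslab_meas _ _).inter ?_
    have hm : Measurable (fun p : Spt n => ‖p.1 - x‖) := by fun_prop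
    exact (measurableSet_le measurable_const hm).inter (measurableSet_lt hm measurable_const)
  have hcover : Tslab ((x : Eu n), (0 : ℝ)) ρ ⊆ ⋃ k, A k := by
    intro p hp
    rw [mem_iUnion]
    exact ⟨⌊‖p.1 - x‖⌋₊, hp, Nat.floor_le (norm_nonneg _), Nat.lt_floor_add_one _⟩
  set b : ℕ → ℝ := fun k => C * Real.exp (-c * k) * (Λ * ((k:ℝ) + 1 + 2 * ρ) ^ n) with hb
  have hsum : Summable b := by
    have h0 := (summable_nat_add_iff 1).2 (Real.summable_pow_mul_exp_neg_nat_mul n hcpos)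
    have h1 := h0.mul_left (C * Λ * Real.exp c * (1 + 2 * ρ) ^ n)
    refine Summable.of_nonneg_of_le (fun k => by positivity) (fun k => ?_) h1
    have he : Real.exp (-c * k) = Real.exp c * Real.exp (-c * ((k + 1 : ℕ) : ℝ)) := by
      rw [← Real.exp_add]; congr 1; push_cast; ring
    have hp : ((k:ℝ) + 1 + 2 * ρ) ^ n ≤ (1 + 2 * ρ) ^ n * ((k + 1 : ℕ) : ℝ) ^ n := by
      rw [← mul_pow]
      gcongr
      push_cast
      have : (0:ℝ) ≤ ρ * k := by positivity
      nlinarith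
    calc b k ≤ C * (Real.exp c * Real.exp (-c * ((k + 1 : ℕ) : ℝ))) *
          (Λ * ((1 + 2 * ρ) ^ n * ((k + 1 : ℕ) : ℝ) ^ n)) := by
            simp only [hb]; rw [he]; gcongr
      _ = _ := by ring
  have hAk : ∀ k, ∫⁻ p in A k, ‖heatKer n (x, 0) p‖ₑ ∂μ ≤ ENNReal.ofReal (b k) := by
    intro k
    have hμ : μ (A k) ≤ ENNReal.ofReal (Λ * ((k:ℝ) + 1 + 2 * ρ) ^ n) := by
      refine le_trans (measure_mono ?_) (hgrowth ((k:ℝ) + 1 + 2 * ρ) (by positivity) (x, 0))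
      rintro p ⟨⟨h1, h2⟩, h3, h4⟩
      simp only at h1 h2
      have hρ2 : 0 < ρ ^ 2 := by positivity
      have hk0 : (0:ℝ) ≤ k := Nat.cast_nonneg k
      have hbig : 4 * ρ ^ 2 < ((k:ℝ) + 1 + 2 * ρ) ^ 2 := by nlinarith [mul_nonneg hk0 hρ.le]
      refine ⟨?_, ?_, ?_⟩
      · rw [mem_ball_iff_norm]; simp only; linarith
      · simp only; linarith
      · simp only; linarith
    calc ∫⁻ p in A k, ‖heatKer n (x, 0) p‖ₑ ∂μ
        ≤ ∫⁻ p in A k, ENNReal.ofReal (C * Real.exp (-c * k)) ∂μ := by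
          refine setLIntegral_mono' (hAm k) (fun p hp => ?_)
          rw [← ofReal_norm]
          exact ENNReal.ofReal_le_ofReal (hk_bound x ρ hρ k p hp.1 hp.2.1)
      _ = ENNReal.ofReal (C * Real.exp (-c * k)) * μ (A k) := setLIntegral_const _ _
      _ ≤ ENNReal.ofReal (C * Real.exp (-c * k)) *
            ENNReal.ofReal (Λ * ((k:ℝ) + 1 + 2 * ρ) ^ n) := by gcongr
      _ = ENNReal.ofReal (b k) := by
          rw [← ENNReal.ofReal_mul (by positivity)]
  calc ∫⁻ p in Tslab ((x : Eu n), (0 : ℝ)) ρ, ‖heatKer n (x, 0) p‖ₑ ∂μ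
      ≤ ∫⁻ p in ⋃ k, A k, ‖heatKer n (x, 0) p‖ₑ ∂μ := lintegral_mono_set hcover
    _ ≤ ∑' k, ∫⁻ p in A k, ‖heatKer n (x, 0) p‖ₑ ∂μ := lintegral_iUnion_le _ _
    _ ≤ ∑' k, ENNReal.ofReal (b k) := ENNReal.tsum_le_tsum hAk
    _ < ⊤ := hsum.tsum_ofReal_lt_top

theorem int_congr_neg {n : ℕ} (μ ν : Measure (Spt n))
    (h : μ.restrict (negTimes n) = ν.restrict (negTimes n)) (ρ : ℝ) (hρ : 0 < ρ)
    (f : Spt n → ℝ) :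
    ∫ p in Tslab ((0 : Eu n), (0:ℝ)) ρ, f p ∂μ = ∫ p in Tslab ((0 : Eu n), (0:ℝ)) ρ, f p ∂ν := by
  rw [← Measure.restrict_restrict_of_subset (tslab_neg (0 : Eu n) ρ hρ), h,
    Measure.restrict_restrict_of_subset (tslab_neg (0 : Eu n) ρ hρ)]

theorem trans_eq {n : ℕ} (μ : Measure (Spt n)) (V : Submodule ℝ (Eu n))
    (hinv : BackInvariantMeas μ V) (ρ : ℝ) (hρ : 0 < ρ) (x : Eu n) (hx : x ∈ V) :
    ∫ p in Tslab ((x : Eu n), (0 : ℝ)) ρ, heatKer n (x, 0) p ∂μ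
      = ∫ p in Tslab ((0 : Eu n), (0 : ℝ)) ρ, heatKer n ((0 : Eu n), (0 : ℝ)) p ∂μ := by
  rw [← int_congr_neg _ _ (hinv x hx) ρ hρ,
    setIntegral_map (tslab_meas _ _) (hk_meas _).aestronglyMeasurable
      (Measurable.aemeasurable (by fun_prop))]
  have hset : (fun p : Spt n => (p.1 - x, p.2)) ⁻¹' Tslab ((0 : Eu n), (0 : ℝ)) ρ
      = Tslab (x, (0:ℝ)) ρ := rfl
  rw [hset]
  simp [heatKer]

theorem scale_eq {n : ℕ} (μ : Measure (Spt n))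
    (hss : BackSelfSimilarMeas μ ((0 : Eu n), (0 : ℝ))) (ρ : ℝ) (hρ : 0 < ρ) :
    ∫ p in Tslab ((0 : Eu n), (0 : ℝ)) ρ, heatKer n ((0 : Eu n), (0 : ℝ)) p ∂μ
      = ∫ p in Tslab ((0 : Eu n), (0 : ℝ)) 1, heatKer n ((0 : Eu n), (0 : ℝ)) p ∂μ := by
  have h1 : scaledMeas ((0 : Eu n), (0 : ℝ)) 1 μ = μ := by
    simp [scaledMeas]
  have h := hss ρ hρ
  rw [h1] at h
  have hpi := Real.pi_pos
  have hρ2 : 0 < ρ ^ 2 := by positivity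
  rw [← int_congr_neg _ _ h 1 one_pos]
  unfold scaledMeas
  rw [Measure.restrict_smul, integral_smul_measure,
    setIntegral_map (tslab_meas _ _) (hk_meas _).aestronglyMeasurable
      (Measurable.aemeasurable (by fun_prop))]
  have hset : (fun p : Spt n => (ρ⁻¹ • (p.1 - (0 : Eu n)), (p.2 - 0) / ρ ^ 2)) ⁻¹'
      Tslab ((0 : Eu n), (0 : ℝ)) 1 = Tslab ((0 : Eu n), (0:ℝ)) ρ := by
    ext p
    simp only [Tslab, mem_preimage, mem_ofPred_eq]
    rw [le_div_iff₀ hρ2, div_le_iff₀ hρ2]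
    ring_nf
  rw [hset, ENNReal.toReal_ofReal (by positivity), ← integral_smul]
  refine setIntegral_congr_fun (tslab_meas _ _) (fun p hp => ?_)
  have hneg : p.2 < 0 := tslab_neg (0 : Eu n) ρ hρ hp
  have hs : 0 < 0 - p.2 := by linarith
  simp only [heatKer, sub_zero, smul_eq_mul]
  have e1 : 4 * π * (0 - p.2 / ρ ^ 2) = (4 * π * (0 - p.2)) / ρ ^ 2 := by ring
  have e2 : (ρ ^ 2) ^ (-(n : ℝ) / 2) = ρ⁻¹ ^ n := by
    rw [← Real.rpow_natCast ρ 2, ← Real.rpow_mul hρ.le, ← Real.rpow_natCast,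
      Real.inv_rpow hρ.le, ← Real.rpow_neg hρ.le]
    congr 1
    push_cast
    ring
  have e3 : -‖ρ⁻¹ • p.1‖ ^ 2 / (4 * (0 - p.2 / ρ ^ 2)) = -‖p.1‖ ^ 2 / (4 * (0 - p.2)) := by
    rw [norm_smul, norm_inv, Real.norm_of_nonneg hρ.le]
    rw [show 4 * (0 - p.2 / ρ ^ 2) = (4 * (0 - p.2)) / ρ ^ 2 by ring, mul_pow, inv_pow]
    field_simp
  have e4 : ρ⁻¹ ^ n ≠ 0 := by positivity
  rw [e1, Real.div_rpow (by positivity) hρ2.le, e2, e3]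
  field_simp

/-- used in Proposition 2.14: constancy of the Gaussian density of
an invariant self-similar measure.
If `μ` has the uniform growth bound `μ(P_ρ(X)) ≤ Λ ρⁿ`, is backwardly self-similar at
`(0,0)` and backwardly invariant with respect to `V`, then for every `ρ > 0` and
`x ∈ V` the Gaussian density `Φ(μ,(x,0),ρ) = (1/2)∫_{T_ρ((x,0))} G_{(x,0)} dμ` is
finite and equals `Φ(μ, (0,0), 1)`. -/
theorem statement11 {n : ℕ} (Λ : ℝ) (hΛ : 0 < Λ)
    (μ : Measure (Spt n)) [IsLocallyFiniteMeasure μ]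
    (hgrowth : ∀ ρ : ℝ, 0 < ρ → ∀ X : Spt n, μ (pball X ρ) ≤ ENNReal.ofReal (Λ * ρ ^ n))
    (V : Submodule ℝ (Eu n))
    (hss : BackSelfSimilarMeas μ ((0 : Eu n), (0 : ℝ)))
    (hinv : BackInvariantMeas μ V) :
    ∀ ρ : ℝ, 0 < ρ → ∀ x ∈ V,
      MeasureTheory.IntegrableOn (heatKer n (x, 0)) (Tslab ((x : Eu n), (0 : ℝ)) ρ) μ ∧
      1 / 2 * (∫ p in Tslab ((x : Eu n), (0 : ℝ)) ρ, heatKer n (x, 0) p ∂μ)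
        = 1 / 2 * ∫ p in Tslab ((0 : Eu n), (0 : ℝ)) 1, heatKer n ((0 : Eu n), (0 : ℝ)) p ∂μ := by
  intro ρ hρ x hx
  exact ⟨hk_integrable Λ hΛ μ hgrowth ρ hρ x, by
    rw [trans_eq μ V hinv ρ hρ x hx, scale_eq μ hss ρ hρ]⟩
end
end
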